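/- arXiv:2205.08691 — 2 statements merged into one kernel-verified Lean document; each statement's English description precedes it below -/
import Mathlib

section
/- Let { n_t } be a strictly increasing sequence of positive integers with n_1 = 1. For t >= 1 set J = n_{t+1} - n_t and r~_t = (prod_{n=n_t}^{n_{t+1}-1} (r_n + 1)) - 1, and define the spacer sequence s~ by: for all choices 0 <= i_j <= r_{n_t + j} (0 <= j < J), the spacer at index i_0 + i_1 (r_{n_t}+1) + i_2 (r_{n_t}+1)(r_{n_t+1}+1) + ... + i_{J-1} (r_{n_t}+1)...(r_{n_{t+1}-1}+1)/(r_{n_{t+1}-1}+1) (i.e., the mixed-radix index sum_{j<J} i_j * prod_{k<j}(r_{n_t+k}+1)) equals s_{n_t, i_0} plus the sum over 1 <= j <= J-1 of s_{n_t + j, i_j} if i_k = r_{n_t+k} for all 0 <= k < j, and 0 otherwise. Then the word sequence B~ built from (r~, s~) satisfies B~_t = B_{n_t} for all t >= 1; in particular the two rank-one word sequences generate the same language. -/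
/-- The rank-one word sequence: `B 1 = 0` and `B (n+1) = ∏_{i=0}^{r n} B n 1^{s n i}`
over the alphabet `{0,1}` (encoded as `Bool` with `false = 0`, `true = 1`).
The value at `0` is an irrelevant placeholder. -/
def Bseq (r : ℕ → ℕ) (s : ℕ → ℕ → ℕ) : ℕ → List Bool
  | 0 => [false]
  | 1 => [false]
  | n + 2 =>
      ((List.range (r (n + 1) + 1)).map
        (fun i => Bseq r s (n + 1) ++ List.replicate (s (n + 1) i) true)).flatten

/-- The language of the rank-one subshift: all factors of some `B n`. -/
def InLang (r : ℕ → ℕ) (s : ℕ → ℕ → ℕ) (w : List Bool) : Prop :=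
  ∃ n, w <:+: Bseq r s n

/-- The product of the first `j` digit bases `r (m + k) + 1` of the mixed-radix system at `m`. -/
def radixProd (r : ℕ → ℕ) (m j : ℕ) : ℕ := ∏ k ∈ Finset.range j, (r (m + k) + 1)

lemma radixProd_zero (r : ℕ → ℕ) (m : ℕ) : radixProd r m 0 = 1 := by
  simp [radixProd]

lemma radixProd_succ (r : ℕ → ℕ) (m j : ℕ) :
    radixProd r m (j + 1) = radixProd r m j * (r (m + j) + 1) :=
  Finset.prod_range_succ _ _

lemma radixProd_pos (r : ℕ → ℕ) (m j : ℕ) : 0 < radixProd r m j :=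
  Finset.prod_pos fun _ _ => Nat.succ_pos _

lemma radixProd_dvd (r : ℕ → ℕ) (m : ℕ) {j k : ℕ} (h : j ≤ k) :
    radixProd r m j ∣ radixProd r m k :=
  Finset.prod_dvd_prod_of_subset _ _ _ (Finset.range_mono h)

/-- The `j`-th mixed-radix digit of `x`. -/
def radixDigit (r : ℕ → ℕ) (m x j : ℕ) : ℕ := x % radixProd r m (j + 1) / radixProd r m j

lemma radixDigit_eq (r : ℕ → ℕ) (m x j : ℕ) :
    radixDigit r m x j = x / radixProd r m j % (r (m + j) + 1) := by
  rw [radixDigit, radixProd_succ, Nat.mod_mul_right_div_self]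

lemma radixDigit_le (r : ℕ → ℕ) (m x j : ℕ) : radixDigit r m x j ≤ r (m + j) := by
  rw [radixDigit_eq]
  exact Nat.le_of_lt_succ (Nat.mod_lt _ (Nat.succ_pos _))

lemma mod_radixProd_succ (r : ℕ → ℕ) (m x j : ℕ) :
    x % radixProd r m (j + 1) =
      x % radixProd r m j + radixProd r m j * radixDigit r m x j := by
  rw [radixDigit_eq, radixProd_succ, Nat.mod_mul]

lemma sum_radixDigit (r : ℕ → ℕ) (m x J : ℕ) :
    ∑ j ∈ Finset.range J, radixDigit r m x j * radixProd r m j = x % radixProd r m J := by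
  induction J with
  | zero => simp [radixProd_zero, Nat.mod_one]
  | succ J ih => rw [Finset.sum_range_succ, ih, mod_radixProd_succ, mul_comm (radixDigit r m x J)]

lemma forall_radixDigit_eq_iff (r : ℕ → ℕ) (m x j : ℕ) :
    (∀ k, k < j → radixDigit r m x k = r (m + k)) ↔
      x % radixProd r m j + 1 = radixProd r m j := by
  induction j with
  | zero => simp [radixProd_zero, Nat.mod_one]
  | succ j ih =>
    rw [Nat.forall_lt_succ_right, ih, mod_radixProd_succ, radixProd_succ]
    have hlt := Nat.mod_lt x (radixProd_pos r m j)
    have hle := radixDigit_le r m x j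
    constructor
    · rintro ⟨h, hd⟩
      rw [hd]
      linarith
    · intro h
      have hd : radixDigit r m x j = r (m + j) := by
        by_contra hne
        have : radixProd r m j * (radixDigit r m x j + 1) ≤ radixProd r m j * r (m + j) :=
          Nat.mul_le_mul_left _ (by omega)
        linarith [radixProd_pos r m j]
      rw [hd] at h
      exact ⟨by linarith, hd⟩

/-- The spacer at mixed-radix index `x` when the `J` stages from `m` on are collapsed into one. -/
def collapsedSpacer (r : ℕ → ℕ) (s : ℕ → ℕ → ℕ) (m J x : ℕ) : ℕ :=
  ∑ j ∈ Finset.range J,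
    if x % radixProd r m j + 1 = radixProd r m j then s (m + j) (radixDigit r m x j) else 0

lemma collapsedSpacer_congr (r : ℕ → ℕ) (s : ℕ → ℕ → ℕ) (m J : ℕ) {x y : ℕ}
    (h : x ≡ y [MOD radixProd r m J]) :
    collapsedSpacer r s m J x = collapsedSpacer r s m J y := by
  refine Finset.sum_congr rfl fun j hj => ?_
  have hj := Finset.mem_range.mp hj
  have h₁ : x % radixProd r m j = y % radixProd r m j := h.of_dvd (radixProd_dvd r m hj.le)
  have h₂ : x % radixProd r m (j + 1) = y % radixProd r m (j + 1) := h.of_dvd (radixProd_dvd r m hj)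
  rw [radixDigit, radixDigit, h₁, h₂]

lemma collapsedSpacer_succ (r : ℕ → ℕ) (s : ℕ → ℕ → ℕ) (m J : ℕ) {y a : ℕ}
    (hy : y < radixProd r m J) (ha : a ≤ r (m + J)) :
    collapsedSpacer r s m (J + 1) (y + radixProd r m J * a) =
      collapsedSpacer r s m J y + if y + 1 = radixProd r m J then s (m + J) a else 0 := by
  have hd : radixDigit r m (y + radixProd r m J * a) J = a := by
    rw [radixDigit_eq, Nat.add_mul_div_left _ _ (radixProd_pos r m J), Nat.div_eq_of_lt hy,
      zero_add, Nat.mod_eq_of_lt (Nat.lt_succ_of_le ha)]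
  rw [collapsedSpacer, Finset.sum_range_succ, hd, Nat.add_mul_mod_self_left, Nat.mod_eq_of_lt hy]
  congr 1
  exact collapsedSpacer_congr r s m J (Nat.add_mul_mod_self_left _ _ _)

/-- The concatenation of `b 1^{σ i}` over `i < N`. -/
def spacedPow (b : List Bool) (N : ℕ) (σ : ℕ → ℕ) : List Bool :=
  ((List.range N).map fun i => b ++ List.replicate (σ i) true).flatten

lemma Bseq_succ (r : ℕ → ℕ) (s : ℕ → ℕ → ℕ) {n : ℕ} (hn : 1 ≤ n) :
    Bseq r s (n + 1) = spacedPow (Bseq r s n) (r n + 1) (s n) := by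
  obtain ⟨n, rfl⟩ := Nat.exists_eq_add_of_le' hn
  rfl

lemma spacedPow_zero (b : List Bool) (σ : ℕ → ℕ) : spacedPow b 0 σ = [] := rfl

lemma spacedPow_succ (b : List Bool) (N : ℕ) (σ : ℕ → ℕ) :
    spacedPow b (N + 1) σ = spacedPow b N σ ++ (b ++ List.replicate (σ N) true) := by
  simp [spacedPow, List.range_succ]

lemma spacedPow_congr (b : List Bool) {N : ℕ} {σ τ : ℕ → ℕ} (h : ∀ i < N, σ i = τ i) :
    spacedPow b N σ = spacedPow b N τ := by
  unfold spacedPow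
  congr 1
  exact List.map_congr_left fun i hi => by rw [h i (List.mem_range.mp hi)]

lemma spacedPow_add (b : List Bool) (M N : ℕ) (σ : ℕ → ℕ) :
    spacedPow b (M + N) σ = spacedPow b M σ ++ spacedPow b N fun i => σ (i + M) := by
  induction N with
  | zero => simp [spacedPow_zero]
  | succ N ih => rw [← add_assoc, spacedPow_succ, ih, spacedPow_succ, add_comm M N,
      List.append_assoc]

lemma spacedPow_add_last (b : List Bool) {N : ℕ} (hN : 0 < N) (σ : ℕ → ℕ) (e : ℕ) :
    spacedPow b N (fun i => σ i + if i + 1 = N then e else 0) =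
      spacedPow b N σ ++ List.replicate e true := by
  obtain ⟨N, rfl⟩ := Nat.exists_eq_add_of_le' hN
  rw [spacedPow_succ, spacedPow_succ, spacedPow_congr b (τ := σ)]
  · simp only [if_true, List.replicate_add, List.append_assoc]
  · intro i hi
    simp [hi.ne]

lemma spacedPow_mul (b : List Bool) {P : ℕ} (hP : 0 < P) (N : ℕ) (σ ρ τ : ℕ → ℕ)
    (h : ∀ a < N, ∀ y < P, σ (y + P * a) = ρ y + if y + 1 = P then τ a else 0) :
    spacedPow b (P * N) σ = spacedPow (spacedPow b P ρ) N τ := by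
  induction N with
  | zero => rfl
  | succ N ih =>
    rw [Nat.mul_succ, spacedPow_add, spacedPow_succ, ih fun a ha => h a (ha.trans N.lt_succ_self),
      ← spacedPow_add_last b hP, spacedPow_congr b (h N N.lt_succ_self)]

lemma Bseq_add (r : ℕ → ℕ) (s : ℕ → ℕ → ℕ) {m : ℕ} (hm : 1 ≤ m) (J : ℕ) :
    Bseq r s (m + J) =
      spacedPow (Bseq r s m) (radixProd r m J) (collapsedSpacer r s m J) := by
  induction J with
  | zero => simp [radixProd_zero, spacedPow, collapsedSpacer]
  | succ J ih =>
    rw [← add_assoc, Bseq_succ r s (hm.trans (Nat.le_add_right m J)), ih, radixProd_succ]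
    exact (spacedPow_mul _ (radixProd_pos r m J) _ _ _ _ fun a ha y hy =>
      collapsedSpacer_succ r s m J hy (Nat.le_of_lt_succ ha)).symm

lemma Bseq_prefix_succ (r : ℕ → ℕ) (s : ℕ → ℕ → ℕ) (n : ℕ) :
    Bseq r s n <+: Bseq r s (n + 1) := by
  cases n with
  | zero => exact List.prefix_rfl
  | succ n =>
    rw [Bseq_succ r s (Nat.le_add_left 1 n), spacedPow, List.range_succ_eq_map, List.map_cons,
      List.flatten_cons, List.append_assoc]
    exact List.prefix_append _ _

lemma Bseq_prefix_of_le (r : ℕ → ℕ) (s : ℕ → ℕ → ℕ) {m n : ℕ} (h : m ≤ n) :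
    Bseq r s m <+: Bseq r s n := by
  induction n, h using Nat.le_induction with
  | base => exact List.prefix_rfl
  | succ n _ ih => exact ih.trans (Bseq_prefix_succ r s n)

/-- Collapsing the stages between consecutive terms of a strictly increasing sequence
`n_t` (with `n_1 = 1`) into single stages, with the mixed-radix spacer sequence described,
yields a word sequence `B~` with `B~ t = B (n_t)` for all `t ≥ 1`; in particular the two
constructions generate the same language. -/
theorem stmt4 (r r' : ℕ → ℕ) (s s' : ℕ → ℕ → ℕ) (hr : ∀ n, 1 ≤ r n)
    (nseq : ℕ → ℕ) (hmono : ∀ t, 1 ≤ t → nseq t < nseq (t + 1)) (hn1 : nseq 1 = 1)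
    (hr' : ∀ t, 1 ≤ t →
      r' t = (∏ n ∈ Finset.Ico (nseq t) (nseq (t + 1)), (r n + 1)) - 1)
    (hs' : ∀ t, 1 ≤ t → ∀ i : ℕ → ℕ,
      (∀ j, j < nseq (t + 1) - nseq t → i j ≤ r (nseq t + j)) →
      s' t (∑ j ∈ Finset.range (nseq (t + 1) - nseq t),
          i j * ∏ k ∈ Finset.range j, (r (nseq t + k) + 1)) =
        s (nseq t) (i 0) +
          ∑ j ∈ Finset.Ico 1 (nseq (t + 1) - nseq t),
            (if ∀ k, k < j → i k = r (nseq t + k) then s (nseq t + j) (i j) else 0)) :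
    (∀ t, 1 ≤ t → Bseq r' s' t = Bseq r s (nseq t)) ∧
      (∀ w : List Bool, InLang r' s' w ↔ InLang r s w) := by
  have hle : ∀ t, 1 ≤ t → t ≤ nseq t := by
    intro t ht
    induction t, ht using Nat.le_induction with
    | base => exact hn1.ge
    | succ t ht ih => exact Nat.succ_le_of_lt (ih.trans_lt (hmono t ht))
  have hB : ∀ t, 1 ≤ t → Bseq r' s' t = Bseq r s (nseq t) := by
    intro t ht
    induction t, ht using Nat.le_induction with
    | base => rw [hn1]; rfl
    | succ t ht ih =>
      have hlt := hmono t ht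
      have hr't := hr' t ht
      have hs't := hs' t ht
      have hJ : nseq (t + 1) = nseq t + (nseq (t + 1) - nseq t) := by omega
      have hJ0 : 0 < nseq (t + 1) - nseq t := by omega
      rw [Finset.prod_Ico_eq_prod_range] at hr't
      generalize nseq (t + 1) - nseq t = J at *
      change r' t = radixProd r (nseq t) J - 1 at hr't
      rw [hJ, Bseq_add r s (ht.trans (hle t ht)), Bseq_succ r' s' ht, ih, hr't,
        Nat.sub_add_cancel (radixProd_pos r _ J)]
      refine spacedPow_congr _ fun x hx => ?_
      have key := hs't (radixDigit r (nseq t) x) fun j _ => radixDigit_le r _ x j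
      have hsum := sum_radixDigit r (nseq t) x J
      rw [Nat.mod_eq_of_lt hx] at hsum
      unfold radixProd at hsum
      rw [hsum] at key
      rw [key, collapsedSpacer, Finset.range_eq_Ico, Finset.sum_eq_sum_Ico_succ_bot hJ0]
      simp only [forall_radixDigit_eq_iff]
      simp [radixProd_zero, Nat.mod_one]
  refine ⟨hB, fun w => ⟨?_, ?_⟩⟩
  · rintro ⟨n, hw⟩
    rcases n.eq_zero_or_pos with rfl | hn
    · exact ⟨0, hw⟩
    · exact ⟨nseq n, hB n hn ▸ hw⟩
  · rintro ⟨n, hw⟩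
    refine ⟨n + 1, ?_⟩
    rw [hB (n + 1) n.succ_pos]
    exact hw.trans (Bseq_prefix_of_le r s (n.le_succ.trans (hle (n + 1) n.succ_pos))).isInfix
end

section
/- Assume there are N in N and an integer d >= 1 such that for all n >= N: s_{n,i} is in {0, d} for all 0 <= i < r_n, s_{n,r_n} = 0, and s_{n,i} is not constant over 0 <= i < r_n. Fix n >= N and q_n > h_n, and write f_n = p(h_n) - h_n. If there are t_n distinct right-special words, each of length at least h_n and less than q_n, none of which is a suffix of B_{n+m} for any m >= 1, then p(q_n) >= q_n + f_n + t_n. -/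
/-- The word complexity: the number of words of length `q` in the language. -/
noncomputable def complexity (r : ℕ → ℕ) (s : ℕ → ℕ → ℕ) (q : ℕ) : ℕ :=
  Set.ncard {w : List Bool | w.length = q ∧ InLang r s w}

/-- A word `w` is right-special if both `w0` and `w1` belong to the language. -/
def RightSpecial (r : ℕ → ℕ) (s : ℕ → ℕ → ℕ) (w : List Bool) : Prop :=
  InLang r s (w ++ [false]) ∧ InLang r s (w ++ [true])

theorem Bseq_succ_s8 (r : ℕ → ℕ) (s : ℕ → ℕ → ℕ) {n : ℕ} (hn : 1 ≤ n) :
    Bseq r s (n + 1) = ((List.range (r n + 1)).map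
      (fun i => Bseq r s n ++ List.replicate (s n i) true)).flatten := by
  obtain ⟨k, rfl⟩ := Nat.exists_eq_add_of_le' hn
  rw [Bseq]

/-- Every `B n` starts with `0`. -/
theorem exists_Bseq_eq_false_cons (r : ℕ → ℕ) (s : ℕ → ℕ → ℕ) (n : ℕ) :
    ∃ t, Bseq r s n = false :: t := by
  induction n with
  | zero => exact ⟨[], by rw [Bseq]⟩
  | succ n ih =>
    rcases Nat.eq_zero_or_pos n with rfl | hn
    · exact ⟨[], by rw [Bseq]⟩
    · obtain ⟨t, ht⟩ := ih
      rw [Bseq_succ_s8 r s hn, List.range_succ_eq_map, ht]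
      exact ⟨_, rfl⟩

theorem pair_infix_range {i m : ℕ} (h : i + 1 < m) : [i, i + 1] <:+: List.range m := by
  refine ⟨List.range' 0 i, List.range' (i + 2) (m - i - 2), ?_⟩
  have h1 : [i, i + 1] = List.range' (0 + i) 2 := by simp [List.range'_succ]
  have h2 : List.range' 0 i ++ List.range' (0 + i) 2 = List.range' 0 (i + 2) := by
    simpa using List.range'_append_1 (s := 0) (m := i) (n := 2)
  have h3 : List.range' 0 (i + 2) ++ List.range' (0 + (i + 2)) (m - i - 2) =
      List.range' 0 (i + 2 + (m - i - 2)) := List.range'_append_1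
  rw [Nat.zero_add] at h3
  rw [h1, h2, List.range_eq_range', h3]
  congr 1
  omega

/-- Two consecutive copies of `B n`, with the spacers between them, occur in `B (n+1)`. -/
theorem Bseq_spacer_Bseq_infix (r : ℕ → ℕ) (s : ℕ → ℕ → ℕ) {n i : ℕ} (hn : 1 ≤ n)
    (hi : i < r n) :
    Bseq r s n ++ List.replicate (s n i) true ++ Bseq r s n <:+: Bseq r s (n + 1) := by
  obtain ⟨a, b, hab⟩ := pair_infix_range (Nat.succ_lt_succ hi)
  rw [Bseq_succ_s8 r s hn, ← hab]
  refine ⟨(a.map fun i => Bseq r s n ++ List.replicate (s n i) true).flatten,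
    List.replicate (s n (i + 1)) true ++
      (b.map fun i => Bseq r s n ++ List.replicate (s n i) true).flatten, ?_⟩
  simp

theorem InLang.of_infix {r : ℕ → ℕ} {s : ℕ → ℕ → ℕ} {v w : List Bool} (hw : InLang r s w)
    (h : v <:+: w) : InLang r s v :=
  hw.imp fun _ hn => h.trans hn

theorem InLang.exists_append_singleton {r : ℕ → ℕ} {s : ℕ → ℕ → ℕ} (hr : ∀ n, 1 ≤ r n)
    {w : List Bool} (hw : InLang r s w) : ∃ c, InLang r s (w ++ [c]) := by
  obtain ⟨n, hn1, hn⟩ : ∃ n, 1 ≤ n ∧ w <:+: Bseq r s n := by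
    obtain ⟨n, hn⟩ := hw
    rcases Nat.eq_zero_or_pos n with rfl | h
    · exact ⟨1, le_rfl, by simpa only [Bseq] using hn⟩
    · exact ⟨n, h, hn⟩
  obtain ⟨a, b, hab⟩ := hn
  obtain ⟨t, ht⟩ := exists_Bseq_eq_false_cons r s n
  have key := Bseq_spacer_Bseq_infix r s (i := 0) hn1 (hr n)
  obtain ⟨c, u, hcu⟩ : ∃ c u, b ++ (List.replicate (s n 0) true ++ Bseq r s n) = c :: u := by
    apply List.exists_cons_of_ne_nil
    simp [ht]
  refine ⟨c, n + 1, List.IsInfix.trans ⟨a, u, ?_⟩ key⟩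
  have : Bseq r s n ++ List.replicate (s n 0) true ++ Bseq r s n =
      a ++ w ++ (b ++ (List.replicate (s n 0) true ++ Bseq r s n)) := by
    rw [← List.append_assoc, hab, List.append_assoc]
  rw [this, hcu]
  simp

theorem add_length_Bseq_le (r : ℕ → ℕ) (s : ℕ → ℕ → ℕ) (hr : ∀ n, 1 ≤ r n) {n : ℕ}
    (hn : 1 ≤ n) (m : ℕ) : m + (Bseq r s n).length ≤ (Bseq r s (n + m)).length := by
  induction m with
  | zero => simp
  | succ m ih =>
    have h := (Bseq_spacer_Bseq_infix r s (n := n + m) (i := 0) (by omega) (hr _)).length_le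
    obtain ⟨t, ht⟩ := exists_Bseq_eq_false_cons r s (n + m)
    have hpos : 1 ≤ (Bseq r s (n + m)).length := by simp [ht]
    simp only [List.length_append, List.length_replicate] at h
    rw [← Nat.add_assoc n m 1]
    omega

theorem RightSpecial.of_suffix {r : ℕ → ℕ} {s : ℕ → ℕ → ℕ} {v w : List Bool}
    (hw : RightSpecial r s w) (h : v <:+ w) : RightSpecial r s v := by
  obtain ⟨a, rfl⟩ := h
  exact ⟨hw.1.of_infix ⟨a, [], by simp⟩, hw.2.of_infix ⟨a, [], by simp⟩⟩

theorem rightSpecial_Bseq {r : ℕ → ℕ} {s : ℕ → ℕ → ℕ} {n : ℕ} (hn : 1 ≤ n)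
    (h0 : ∃ i < r n, s n i = 0) (h1 : ∃ i < r n, 1 ≤ s n i) :
    RightSpecial r s (Bseq r s n) := by
  obtain ⟨i, hi, hi0⟩ := h0
  obtain ⟨j, hj, hj1⟩ := h1
  constructor
  · obtain ⟨t, ht⟩ := exists_Bseq_eq_false_cons r s n
    have h := Bseq_spacer_Bseq_infix r s hn hi
    refine ⟨n + 1, List.IsInfix.trans ⟨[], t, ?_⟩ h⟩
    rw [hi0]
    simp [← ht]
  · have h := Bseq_spacer_Bseq_infix r s hn hj
    obtain ⟨k, hk⟩ := Nat.exists_eq_add_of_le' hj1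
    refine ⟨n + 1, List.IsInfix.trans
      ⟨[], List.replicate k true ++ Bseq r s n, ?_⟩ h⟩
    rw [hk]
    simp [List.replicate_succ]

theorem finite_length_eq_and (l : ℕ) (P : List Bool → Prop) :
    {w : List Bool | w.length = l ∧ P w}.Finite :=
  (List.finite_length_eq Bool l).subset fun _ h => h.1

/-- Each right-special word of length `l` contributes one more word of length `l + 1`. -/
theorem complexity_add_ncard_rightSpecial_le (r : ℕ → ℕ) (s : ℕ → ℕ → ℕ) (hr : ∀ n, 1 ≤ r n)
    (l : ℕ) :
    complexity r s l + {w : List Bool | w.length = l ∧ RightSpecial r s w}.ncard ≤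
      complexity r s (l + 1) := by
  let E : Bool → Set (List Bool) := fun c => {w | w.length = l ∧ InLang r s (w ++ [c])}
  have hfin : ∀ c, (E c).Finite := fun c => finite_length_eq_and l _
  have hunion : {w : List Bool | w.length = l ∧ InLang r s w} ⊆ E false ∪ E true := by
    rintro w ⟨hl, hw⟩
    obtain ⟨c, hc⟩ := hw.exists_append_singleton hr
    cases c
    · exact Or.inl ⟨hl, hc⟩
    · exact Or.inr ⟨hl, hc⟩
  have hinter : {w : List Bool | w.length = l ∧ RightSpecial r s w} ⊆ E false ∩ E true :=
    fun w hw => ⟨⟨hw.1, hw.2.1⟩, ⟨hw.1, hw.2.2⟩⟩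
  have hle1 := Set.ncard_le_ncard hunion ((hfin false).union (hfin true))
  have hle2 := Set.ncard_le_ncard hinter ((hfin false).inter_of_left _)
  have hsum := Set.ncard_union_add_ncard_inter (E false) (E true) (hfin false) (hfin true)
  have hinj : ∀ c : Bool, Function.Injective fun w : List Bool => w ++ [c] :=
    fun c => List.append_left_injective [c]
  have hdisj : Disjoint ((fun w => w ++ [false]) '' E false)
      ((fun w => w ++ [true]) '' E true) := by
    rw [Set.disjoint_left]
    rintro _ ⟨v, -, rfl⟩ ⟨w, -, h⟩
    simpa using (List.append_inj' h rfl).2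
  have himage := Set.ncard_union_eq hdisj ((hfin false).image _) ((hfin true).image _)
  rw [Set.ncard_image_of_injective _ (hinj false),
    Set.ncard_image_of_injective _ (hinj true)] at himage
  have hsub : (fun w => w ++ [false]) '' E false ∪ (fun w => w ++ [true]) '' E true ⊆
      {w : List Bool | w.length = l + 1 ∧ InLang r s w} := by
    rintro _ (⟨w, ⟨hl, hw⟩, rfl⟩ | ⟨w, ⟨hl, hw⟩, rfl⟩)
    · exact ⟨by simp [hl], hw⟩
    · exact ⟨by simp [hl], hw⟩
  have hle3 := Set.ncard_le_ncard hsub (finite_length_eq_and (l + 1) _)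
  unfold complexity
  omega

/-- Under the standing spacer hypotheses, if there are `t_n` distinct right-special words,
each of length at least `h_n` and less than `q_n`, none of which is a suffix of any
`B_{n+m}` (`m ≥ 1`), then `p(q_n) ≥ q_n + (p(h_n) - h_n) + t_n`. -/
theorem stmt8 (r : ℕ → ℕ) (s : ℕ → ℕ → ℕ) (hr : ∀ n, 1 ≤ r n)
    (d : ℕ) (hd : 1 ≤ d) (N : ℕ) (hN : 1 ≤ N)
    (hyp : ∀ n, N ≤ n →
      (∀ i, i < r n → s n i = 0 ∨ s n i = d) ∧
      s n (r n) = 0 ∧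
      (∃ i, i < r n ∧ s n i = 0) ∧ (∃ i, i < r n ∧ s n i = d))
    (n : ℕ) (hn : N ≤ n) (q : ℕ) (hq : (Bseq r s n).length < q)
    (W : Finset (List Bool))
    (hW : ∀ w ∈ W, RightSpecial r s w ∧
      (Bseq r s n).length ≤ w.length ∧ w.length < q ∧
      ∀ m, 1 ≤ m → ¬ (w <:+ Bseq r s (n + m))) :
    (q : ℤ) + ((complexity r s (Bseq r s n).length : ℤ) - ((Bseq r s n).length : ℤ)) +
        (W.card : ℤ) ≤ (complexity r s q : ℤ) := by
  have hn1 : 1 ≤ n := hN.trans hn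
  have step : ∀ l, complexity r s l + ((W.filter fun w => w.length = l).card + 1) ≤
      complexity r s (l + 1) := by
    intro l
    refine le_trans (Nat.add_le_add_left ?_ _) (complexity_add_ncard_rightSpecial_le r s hr l)
    have hlen := add_length_Bseq_le r s hr hn1 (l + 1)
    have hv : (Bseq r s (n + (l + 1))).rtake l <:+ Bseq r s (n + (l + 1)) :=
      List.drop_suffix _ _
    have hvl : ((Bseq r s (n + (l + 1))).rtake l).length = l := by
      simp only [List.rtake, List.length_drop]
      omega
    obtain ⟨-, -, h0, i, hi, hid⟩ := hyp (n + (l + 1)) (by omega)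
    have hvs : RightSpecial r s ((Bseq r s (n + (l + 1))).rtake l) :=
      (rightSpecial_Bseq (by omega) h0 ⟨i, hi, hid ▸ hd⟩).of_suffix hv
    have hvW : (Bseq r s (n + (l + 1))).rtake l ∉ W.filter fun w => w.length = l :=
      fun h => (hW _ (Finset.mem_filter.1 h).1).2.2.2 (l + 1) (by omega) hv
    rw [← Finset.card_cons hvW, ← Set.ncard_coe_finset]
    refine Set.ncard_le_ncard ?_ (finite_length_eq_and l _)
    intro w hw
    rcases Finset.mem_cons.1 (Finset.mem_coe.1 hw) with rfl | h
    · exact ⟨hvl, hvs⟩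
    · obtain ⟨hwW, hwl⟩ := Finset.mem_filter.1 h
      exact ⟨hwl, (hW w hwW).1⟩
  have sum_step : ∀ k, complexity r s (Bseq r s n).length + k +
      (W.filter fun w => w.length < (Bseq r s n).length + k).card ≤
        complexity r s ((Bseq r s n).length + k) := by
    intro k
    induction k with
    | zero =>
      have : (W.filter fun w => w.length < (Bseq r s n).length + 0) = ∅ :=
        Finset.filter_eq_empty_iff.2 fun w hw => not_lt.2 (hW w hw).2.1
      rw [this]
      simp
    | succ k ih =>
      have h := step ((Bseq r s n).length + k)
      have hsplit : (W.filter fun w => w.length < (Bseq r s n).length + (k + 1)) =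
          (W.filter fun w => w.length < (Bseq r s n).length + k) ∪
            W.filter fun w => w.length = (Bseq r s n).length + k := by
        rw [← Finset.filter_or]
        refine Finset.filter_congr fun w _ => ?_
        omega
      have hcard := hsplit ▸ Finset.card_union_le _ _
      rw [← Nat.add_assoc (Bseq r s n).length k 1] at hcard ⊢
      omega
  have h := sum_step (q - (Bseq r s n).length)
  rw [Nat.add_sub_cancel' hq.le, Finset.filter_true_of_mem fun w hw => (hW w hw).2.2.1] at h
  omega
end
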